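/- arXiv:1902.00404 — 7 statements merged into one kernel-verified Lean document; each statement's English description precedes it below -/
import Mathlib

section
/- Let μ ∈ ℂ be an eigenvalue of A₀ with Re μ > 0, and let m be the algebraic multiplicity of μ (the multiplicity of μ as a root of the characteristic polynomial of A₀). Let δ > 0 be such that every z in the closed ball of radius 2δ around μ satisfies Re z > 0 and μ is the only eigenvalue of A₀ in that closed ball. Then there exists ε₀ > 0 such that for every 0 < ε < ε₀ the entire function χ^ε has exactly m zeros in the open ball of radius δ around μ, counted with multiplicity; that is, the sum over all z in that ball with χ^ε(z) = 0 of the order of z as a zero of χ^ε equals m. -/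
open Matrix Complex

/-- Characteristic function χ^ε(λ) = det(−λI + A₀ + Σ_{k=1}^{n} A_k exp(−λ σ_k ε^{−k})). -/
noncomputable def chiFn (d n : ℕ) (A : ℕ → Matrix (Fin d) (Fin d) ℂ) (σ : ℕ → ℝ)
    (ε : ℝ) (z : ℂ) : ℂ :=
  Matrix.det (-z • (1 : Matrix (Fin d) (Fin d) ℂ) + A 0 +
    ∑ k ∈ Finset.Icc 1 n, Complex.exp (-z * (σ k : ℂ) * (((ε⁻¹ : ℝ) : ℂ))^k) • A k)

/-- The order of `z` as a zero of `f`: the least `k` with `iteratedDeriv k f z ≠ 0`. -/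
noncomputable def zeroOrder (f : ℂ → ℂ) (z : ℂ) : ℕ :=
  sInf {k : ℕ | iteratedDeriv k f z ≠ 0}

open Filter Topology Metric

/-- `zeroOrder` agrees with `analyticOrderNatAt`. -/
theorem zeroOrder_eq_analyticOrderNatAt {f : ℂ → ℂ} {z : ℂ} (hf : AnalyticAt ℂ f z)
    (h : analyticOrderAt f z ≠ ⊤) : zeroOrder f z = analyticOrderNatAt f z := by
  obtain ⟨hlt, hne⟩ := (analyticOrderAt_eq_nat_iff_iteratedDeriv_eq_zero hf).1
    (Nat.cast_analyticOrderNatAt h).symm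
  exact le_antisymm (Nat.sInf_le hne)
    (le_csInf ⟨_, hne⟩ fun k hk ↦ not_lt.1 fun hlt' ↦ hk (hlt k hlt'))

/-- The **argument principle** on a disc, for entire functions. -/
theorem circleIntegral_logDeriv_eq {f : ℂ → ℂ} (hf : Differentiable ℂ f) {c : ℂ} {R : ℝ}
    (hR : 0 < R) (h0 : ∀ z ∈ sphere c R, f z ≠ 0) :
    ∮ z in C(c, R), logDeriv f z = 2 * Real.pi * I *
      ((∑ᶠ z ∈ {z : ℂ | z ∈ ball c R ∧ f z = 0}, analyticOrderNatAt f z : ℕ) : ℂ) := by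
  have hfa : ∀ z, AnalyticAt ℂ f z := fun z ↦ hf.analyticAt z
  have hfU : AnalyticOnNhd ℂ f (closedBall c R) := fun z _ ↦ hfa z
  have hne : f ≠ 0 := by
    obtain ⟨w, hw⟩ := NormedSpace.sphere_nonempty (x := c).2 hR.le
    exact fun h ↦ h0 w hw (by simp [h])
  have htop : ∀ z, analyticOrderAt f z ≠ ⊤ := fun z ↦ by
    rwa [ne_eq, AnalyticOnNhd.analyticOrderAt_eq_top_iff_eq_zero z hfa]
  set D := MeromorphicOn.divisor f (closedBall c R) with hD
  have hDfin : D.support.Finite := D.finiteSupport (isCompact_closedBall c R)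
  have hDin : ∀ z ∈ closedBall c R, D z = analyticOrderNatAt f z := fun z hz ↦ by
    rw [hD, MeromorphicOn.AnalyticOnNhd.divisor_apply hfU hz,
      ← Nat.cast_analyticOrderNatAt (htop z)]
    rfl
  have hDsub : ∀ z ∈ D.support, z ∈ ball c R ∧ f z = 0 := fun z hz ↦ by
    have hzU : z ∈ closedBall c R := D.supportWithinDomain hz
    have hz0 : f z = 0 := by
      rw [Function.mem_support, hDin z hzU] at hz
      exact apply_eq_zero_of_analyticOrderNatAt_ne_zero (by exact_mod_cast hz)
    refine ⟨?_, hz0⟩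
    rcases (mem_closedBall.1 hzU).lt_or_eq with h | h
    · exact h
    · exact absurd hz0 (h0 z h)
  have hDsphere : ∀ z ∈ sphere c R, D z = 0 := fun z hz ↦ by
    by_contra h
    exact h0 z hz (hDsub z h).2
  have hcount : (∑ᶠ z ∈ {z : ℂ | z ∈ ball c R ∧ f z = 0}, analyticOrderNatAt f z : ℕ) =
      ∑ u ∈ hDfin.toFinset, analyticOrderNatAt f u := by
    refine finsum_mem_eq_sum_of_inter_support_eq _ ?_
    ext z
    simp only [Set.mem_inter_iff, Set.mem_ofPred_eq, Function.mem_support, Set.Finite.coe_toFinset]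
    constructor
    · rintro ⟨⟨hz, hz0⟩, hz'⟩
      refine ⟨?_, hz'⟩
      rw [hDin z (ball_subset_closedBall hz)]
      exact_mod_cast hz'
    · rintro ⟨hz, hz'⟩
      exact ⟨hDsub z hz, hz'⟩
  obtain ⟨g, hg, hg0, hfg⟩ := MeromorphicOn.extract_zeros_poles hfU.meromorphicOn
    (fun z ↦ by
      rw [(hfa z).meromorphicOrderAt_eq]
      simpa using htop z) hDfin
  have hlog : ∀ z ∈ sphere c R, logDeriv f z =
      ∑ u ∈ hDfin.toFinset, (analyticOrderNatAt f u : ℂ) * (z - u)⁻¹ + logDeriv g z := by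
    intro z hz
    have hzU : z ∈ closedBall c R := sphere_subset_closedBall hz
    have hφ : AnalyticAt ℂ (∏ᶠ u, (· - u) ^ D u : ℂ → ℂ) z :=
      Function.FactorizedRational.analyticAt (hDsphere z hz).ge
    have hacc : AccPt z (𝓟 (closedBall c R)) := by
      refine (convex_closedBall c R).isPreconnected.preperfect_of_nontrivial
        ⟨c, mem_closedBall_self hR.le, z, hzU, fun h ↦ ?_⟩ z hzU
      rw [h, mem_sphere, dist_self] at hz
      exact hR.ne hz
    have hev : f =ᶠ[𝓝 z] (∏ᶠ u, (· - u) ^ D u : ℂ → ℂ) • g := by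
      rw [← ContinuousAt.eventuallyEq_nhds_iff_eventuallyEq_nhdsNE (hfa z).continuousAt
        (hφ.smul (hg z hzU)).continuousAt]
      exact (hfa z).meromorphicAt.eventuallyEq_nhdsNE_of_eventuallyEq_codiscreteWithin
        (hφ.smul (hg z hzU)).meromorphicAt hzU hacc hfg
    have hzu : ∀ u ∈ hDfin.toFinset, z - u ≠ 0 := fun u hu h ↦ by
      rw [← sub_eq_zero.1 h] at hu
      exact (hDfin.mem_toFinset.1 hu) (hDsphere z hz)
    have hprod : (∏ᶠ u, (· - u) ^ D u : ℂ → ℂ) • g =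
        fun w ↦ (∏ u ∈ hDfin.toFinset, (w - u) ^ D u) * g w := by
      rw [finprod_eq_prod_of_mulSupport_subset (s := hDfin.toFinset) _
        (by simp [Function.FactorizedRational.mulSupport])]
      ext w
      simp
    rw [(logDeriv_congr_nhds hev).eq_of_nhds, hprod, logDeriv_mul z
      (Finset.prod_ne_zero_iff.2 fun u hu ↦ zpow_ne_zero _ (hzu u hu)) (hg0 ⟨z, hzU⟩)
      (DifferentiableAt.fun_finsetProd fun u hu ↦
        DifferentiableAt.zpow (by fun_prop) (.inl (hzu u hu)))
      (hg z hzU).differentiableAt,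
      logDeriv_prod (f := fun u w ↦ (w - u) ^ D u)
      (fun u hu ↦ zpow_ne_zero _ (hzu u hu))
      (fun u hu ↦ DifferentiableAt.zpow (by fun_prop) (.inl (hzu u hu)))]
    congr 1
    refine Finset.sum_congr rfl fun u hu ↦ ?_
    rw [logDeriv_fun_zpow (f := fun w ↦ w - u) (by fun_prop),
      hDin u (ball_subset_closedBall (hDsub u (hDfin.mem_toFinset.1 hu)).1)]
    simp [logDeriv_apply]
  have hint : ∀ u ∈ hDfin.toFinset,
      CircleIntegrable (fun z ↦ (analyticOrderNatAt f u : ℂ) * (z - u)⁻¹) c R := by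
    intro u hu
    refine ContinuousOn.circleIntegrable hR.le (continuousOn_const.mul
      (ContinuousOn.inv₀ (by fun_prop) fun z hz h ↦ ?_))
    rw [← sub_eq_zero.1 h] at hu
    exact (hDfin.mem_toFinset.1 hu) (hDsphere z hz)
  have hgan : ∀ z ∈ closedBall c R, AnalyticAt ℂ (logDeriv g) z := fun z hz ↦
    (hg z hz).deriv.div (hg z hz) (hg0 ⟨z, hz⟩)
  have hgc : ContinuousOn (logDeriv g) (closedBall c R) := fun z hz ↦
    (hgan z hz).continuousAt.continuousWithinAt
  rw [circleIntegral.integral_congr hR.le hlog, circleIntegral.integral_add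
      (CircleIntegrable.fun_sum _ hint) ((hgc.mono sphere_subset_closedBall).circleIntegrable hR.le),
    circleIntegral.integral_fun_sum hint,
    Complex.circleIntegral_eq_zero_of_differentiable_on_off_countable hR.le Set.countable_empty hgc
      (fun z hz ↦ (hgan z (ball_subset_closedBall hz.1)).differentiableAt), add_zero, hcount,
    Nat.cast_sum, Finset.mul_sum]
  refine Finset.sum_congr rfl fun u hu ↦ ?_
  rw [circleIntegral.integral_const_mul, circleIntegral.integral_sub_inv_of_mem_ball
    (hDsub u (hDfin.mem_toFinset.1 hu)).1, mul_comm]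

/-- The **theorem of Rouché** on a disc, for entire functions. -/
theorem rouche_ball {f g : ℂ → ℂ} (hf : Differentiable ℂ f) (hg : Differentiable ℂ g) {c : ℂ}
    {R : ℝ} (hR : 0 < R) (hfg : ∀ z ∈ sphere c R, ‖f z - g z‖ < ‖g z‖) :
    ∑ᶠ z ∈ {z : ℂ | z ∈ ball c R ∧ f z = 0}, analyticOrderNatAt f z =
      ∑ᶠ z ∈ {z : ℂ | z ∈ ball c R ∧ g z = 0}, analyticOrderNatAt g z := by
  have hg0 : ∀ z ∈ sphere c R, g z ≠ 0 := fun z hz h ↦ by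
    simpa [h] using (norm_nonneg _).trans_lt (hfg z hz)
  have hf0 : ∀ z ∈ sphere c R, f z ≠ 0 := fun z hz h ↦ by
    simpa [h] using hfg z hz
  have hcont : ∀ {h : ℂ → ℂ}, Differentiable ℂ h → (∀ z ∈ sphere c R, h z ≠ 0) →
      CircleIntegrable (logDeriv h) c R := fun {h} hh h0 ↦
    ContinuousOn.circleIntegrable hR.le fun z hz ↦
      ((hh.analyticAt z).deriv.div (hh.analyticAt z) (h0 z hz)).continuousAt.continuousWithinAt
  have hzero : ∮ z in C(c, R), (logDeriv f z - logDeriv g z) = 0 := by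
    refine circleIntegral.integral_eq_zero_of_hasDerivWithinAt
      (f := fun z ↦ Complex.log (f z / g z)) hR.le fun z hz ↦ HasDerivAt.hasDerivWithinAt ?_
    have hslit : f z / g z ∈ slitPlane := by
      rw [← add_sub_cancel 1 (f z / g z)]
      apply mem_slitPlane_of_norm_lt_one
      rw [div_sub_one (hg0 z hz), norm_div, div_lt_one (norm_pos_iff.2 (hg0 z hz))]
      exact hfg z hz
    have hd := ((hf z).hasDerivAt.div (hg z).hasDerivAt (hg0 z hz)).clog hslit
    have hfz := hf0 z hz
    have hgz := hg0 z hz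
    convert! hd using 1
    rw [logDeriv_apply, logDeriv_apply, Pi.div_apply]
    field_simp
  rw [circleIntegral.integral_sub (hcont hf hf0) (hcont hg hg0),
    circleIntegral_logDeriv_eq hf hR hf0, circleIntegral_logDeriv_eq hg hR hg0, sub_eq_zero] at hzero
  exact_mod_cast mul_left_cancel₀ two_pi_I_ne_zero hzero

/-- The characteristic function is entire. -/
theorem differentiable_chiFn (d n : ℕ) (A : ℕ → Matrix (Fin d) (Fin d) ℂ) (σ : ℕ → ℝ) (ε : ℝ) :
    Differentiable ℂ (chiFn d n A σ ε) := by
  have hentry : ∀ i j, Differentiable ℂ fun z : ℂ ↦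
      (-z • (1 : Matrix (Fin d) (Fin d) ℂ) + A 0 +
        ∑ k ∈ Finset.Icc 1 n, Complex.exp (-z * (σ k : ℂ) * (((ε⁻¹ : ℝ) : ℂ))^k) • A k) i j := by
    intro i j
    simp only [Matrix.add_apply, Matrix.smul_apply, Matrix.sum_apply]
    fun_prop
  intro z
  unfold chiFn
  simp only [Matrix.det_apply]
  exact DifferentiableAt.fun_sum fun τ _ ↦ DifferentiableAt.const_smul
    (DifferentiableAt.fun_finsetProd fun i _ ↦ (hentry _ _) z) _

/-- In the right half-plane the delayed terms disappear in the limit `ε → 0⁺`, locally uniformly. -/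
theorem tendsto_chiFn (d n : ℕ) (A : ℕ → Matrix (Fin d) (Fin d) ℂ) (σ : ℕ → ℝ)
    (hσ : ∀ k, 1 ≤ k → k ≤ n → 0 < σ k) {w : ℂ} (hw : 0 < w.re) :
    Tendsto (fun p : ℝ × ℂ ↦ chiFn d n A σ p.1 p.2) (𝓝[>] 0 ×ˢ 𝓝 w)
      (𝓝 (Matrix.det (-w • (1 : Matrix (Fin d) (Fin d) ℂ) + A 0))) := by
  unfold chiFn
  have hz : Tendsto (fun p : ℝ × ℂ ↦ p.2) (𝓝[>] 0 ×ˢ 𝓝 w) (𝓝 w) := tendsto_snd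
  have hexp : ∀ k ∈ Finset.Icc 1 n, Tendsto (fun p : ℝ × ℂ ↦
      Complex.exp (-p.2 * (σ k : ℂ) * (((p.1⁻¹ : ℝ) : ℂ)) ^ k)) (𝓝[>] 0 ×ˢ 𝓝 w) (𝓝 0) := by
    intro k hk
    rw [Finset.mem_Icc] at hk
    rw [Complex.tendsto_exp_nhds_zero_iff]
    have hre : ∀ p : ℝ × ℂ, (-p.2 * (σ k : ℂ) * (((p.1⁻¹ : ℝ) : ℂ)) ^ k).re =
        -(p.2.re * σ k * (p.1⁻¹) ^ k) := fun p ↦ by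
      rw [← ofReal_pow, re_mul_ofReal, re_mul_ofReal, neg_re]
      ring
    simp only [hre]
    refine tendsto_neg_atTop_atBot.comp (Tendsto.pos_mul_atTop (mul_pos hw (hσ k hk.1 hk.2)) ?_ ?_)
    · exact ((continuous_re.tendsto w).comp hz).mul_const _
    · exact (tendsto_pow_atTop (by omega)).comp (tendsto_inv_nhdsGT_zero.comp tendsto_fst)
  have hmat : Tendsto (fun p : ℝ × ℂ ↦ -p.2 • (1 : Matrix (Fin d) (Fin d) ℂ) + A 0 +
      ∑ k ∈ Finset.Icc 1 n, Complex.exp (-p.2 * (σ k : ℂ) * (((p.1⁻¹ : ℝ) : ℂ)) ^ k) • A k)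
      (𝓝[>] 0 ×ˢ 𝓝 w) (𝓝 (-w • (1 : Matrix (Fin d) (Fin d) ℂ) + A 0 +
      ∑ k ∈ Finset.Icc 1 n, (0 : ℂ) • A k)) :=
    ((hz.neg.smul_const _).add_const _).add
      (tendsto_finsetSum _ fun k hk ↦ (hexp k hk).smul_const _)
  simpa [Function.comp_def] using ((continuous_id.matrix_det).tendsto _).comp hmat

/-- The order of a polynomial function at a point is the root multiplicity. -/
theorem analyticOrderAt_polynomial_eval {p : Polynomial ℂ} (hp : p ≠ 0) (a : ℂ) :
    analyticOrderAt (fun z ↦ p.eval z) a = p.rootMultiplicity a := by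
  have han : AnalyticAt ℂ (fun z ↦ p.eval z) a := p.differentiable.analyticAt a
  rw [han.analyticOrderAt_eq_natCast]
  obtain ⟨q, hq, hdvd⟩ := p.exists_eq_pow_rootMultiplicity_mul_and_not_dvd hp a
  refine ⟨fun z ↦ q.eval z, q.differentiable.analyticAt a,
    fun h ↦ hdvd (Polynomial.dvd_iff_isRoot.2 h), Eventually.of_forall fun z ↦ ?_⟩
  conv_lhs => rw [hq]
  simp

theorem det_neg_smul_one_add_eq {d : ℕ} (M : Matrix (Fin d) (Fin d) ℂ) (z : ℂ) :
    Matrix.det (-z • (1 : Matrix (Fin d) (Fin d) ℂ) + M) = (-1) ^ d * M.charpoly.eval z := by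
  have h := Matrix.det_neg (Matrix.scalar (Fin d) z - M)
  rw [Fintype.card_fin, ← Matrix.eval_charpoly] at h
  rw [← h]
  congr 1
  rw [Matrix.scalar_apply, ← Matrix.smul_one_eq_diagonal, neg_sub, neg_smul, sub_eq_add_neg,
    add_comm]

theorem stmt_0 (d n : ℕ) (hd : 1 ≤ d) (hn : 1 ≤ n)
    (A : ℕ → Matrix (Fin d) (Fin d) ℂ) (σ : ℕ → ℝ)
    (hσ : ∀ k, 1 ≤ k → k ≤ n → 0 < σ k)
    (μ : ℂ) (hμ : (Matrix.charpoly (A 0)).IsRoot μ) (hμre : 0 < μ.re)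
    (m : ℕ) (hm : m = (Matrix.charpoly (A 0)).rootMultiplicity μ)
    (δ : ℝ) (hδ : 0 < δ)
    (hball_re : ∀ z ∈ Metric.closedBall μ (2 * δ), 0 < z.re)
    (hball_eig : ∀ z ∈ Metric.closedBall μ (2 * δ), (Matrix.charpoly (A 0)).IsRoot z → z = μ) :
    ∃ ε₀ > (0 : ℝ), ∀ ε : ℝ, 0 < ε → ε < ε₀ →
      (∑ᶠ z ∈ {z : ℂ | z ∈ Metric.ball μ δ ∧ chiFn d n A σ ε z = 0},
        zeroOrder (chiFn d n A σ ε) z) = m := by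
  set p := (A 0).charpoly
  obtain ⟨q, hq⟩ : ∃ q, q = Polynomial.C ((-1 : ℂ) ^ d) * p := ⟨_, rfl⟩
  have hq0 : q ≠ 0 := by
    rw [hq]
    exact mul_ne_zero (by simp) (A 0).charpoly_monic.ne_zero
  have hroot : ∀ z, q.eval z = 0 ↔ p.IsRoot z := fun z ↦ by simp [hq]
  have hle : δ ≤ 2 * δ := by linarith
  have hsub : sphere μ δ ⊆ closedBall μ (2 * δ) :=
    sphere_subset_closedBall.trans (closedBall_subset_closedBall hle)
  have hne : ∀ z ∈ sphere μ δ, q.eval z ≠ 0 := fun z hz h ↦ by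
    rw [hball_eig z (hsub hz) ((hroot z).1 h), mem_sphere, dist_self] at hz
    exact hδ.ne hz
  have hf0 : ∀ z, Matrix.det (-z • (1 : Matrix (Fin d) (Fin d) ℂ) + A 0) = q.eval z := fun z ↦ by
    rw [det_neg_smul_one_add_eq, hq, Polynomial.eval_mul, Polynomial.eval_C]
  have hlim : ∀ᶠ ε in 𝓝[>] (0 : ℝ), ∀ z ∈ sphere μ δ,
      ‖chiFn d n A σ ε z - q.eval z‖ < ‖q.eval z‖ := by
    have hmem : {x : ℝ × ℂ | ‖chiFn d n A σ x.1 x.2 - q.eval x.2‖ < ‖q.eval x.2‖} ∈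
        𝓝[>] (0 : ℝ) ×ˢ 𝓝ˢ (sphere μ δ) := by
      refine (isCompact_sphere μ δ).mem_prod_nhdsSet_of_forall fun w hw ↦ ?_
      have h1 := tendsto_chiFn d n A σ hσ (hball_re w (hsub hw))
      rw [hf0] at h1
      have h2 : Tendsto (fun x : ℝ × ℂ ↦ q.eval x.2) (𝓝[>] 0 ×ˢ 𝓝 w) (𝓝 (q.eval w)) :=
        (q.continuous.tendsto w).comp tendsto_snd
      refine (h1.sub h2).norm.eventually_lt h2.norm ?_
      simpa using hne w hw
    exact (Filter.Eventually.curry hmem).mono fun ε hε ↦ hε.self_of_nhdsSet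
  obtain ⟨ε₀, hε₀, hε⟩ := mem_nhdsGT_iff_exists_Ioo_subset.1 hlim
  refine ⟨ε₀, hε₀, fun ε h1 h2 ↦ ?_⟩
  have hchi := differentiable_chiFn d n A σ ε
  have hlt : ∀ z ∈ sphere μ δ, ‖chiFn d n A σ ε z - q.eval z‖ < ‖q.eval z‖ := hε ⟨h1, h2⟩
  have hchi0 : chiFn d n A σ ε ≠ 0 := fun h ↦ by
    obtain ⟨w, hw⟩ := NormedSpace.sphere_nonempty (x := μ).2 hδ.le
    simpa [h] using hlt w hw
  have hzeros : {z : ℂ | z ∈ ball μ δ ∧ q.eval z = 0} = {μ} := by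
    ext z
    simp only [Set.mem_ofPred_eq, Set.mem_singleton_iff]
    constructor
    · rintro ⟨hz, hz0⟩
      exact hball_eig z (ball_subset_closedBall.trans (closedBall_subset_closedBall hle) hz)
        ((hroot z).1 hz0)
    · rintro rfl
      exact ⟨mem_ball_self hδ, (hroot z).2 hμ⟩
  calc ∑ᶠ z ∈ {z : ℂ | z ∈ ball μ δ ∧ chiFn d n A σ ε z = 0}, zeroOrder (chiFn d n A σ ε) z
      = ∑ᶠ z ∈ {z : ℂ | z ∈ ball μ δ ∧ chiFn d n A σ ε z = 0},
          analyticOrderNatAt (chiFn d n A σ ε) z :=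
        finsum_mem_congr rfl fun z _ ↦ zeroOrder_eq_analyticOrderNatAt (hchi.analyticAt z) <| by
          rwa [ne_eq, AnalyticOnNhd.analyticOrderAt_eq_top_iff_eq_zero z hchi.analyticAt]
    _ = ∑ᶠ z ∈ {z : ℂ | z ∈ ball μ δ ∧ q.eval z = 0}, analyticOrderNatAt (fun z ↦ q.eval z) z :=
        rouche_ball hchi q.differentiable hδ hlt
    _ = m := by
        rw [hzeros, finsum_mem_singleton, analyticOrderNatAt, analyticOrderAt_polynomial_eval hq0,
          ENat.toNat_natCast, hm, hq, Polynomial.rootMultiplicity_mul (hq ▸ hq0),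
          Polynomial.rootMultiplicity_C, zero_add]
end

section
/- Let c > 0, let (ε_m) be a sequence of positive reals converging to 0, and let (λ_m) be a sequence in ℂ with χ^{ε_m}(λ_m) = 0 and Re λ_m ≥ c for all m. If λ_m converges to some λ⁰ ∈ ℂ, then λ⁰ is an eigenvalue of A₀, i.e. det(−λ⁰ I + A₀) = 0. -/
open Matrix Complex Filter

/-- If `Re z ≥ c > 0` along a filter and the real factor `r` tends to infinity, then
`exp (-z * s * r ^ k)` tends to zero for every `s > 0` and `k ≠ 0`. -/
theorem tendsto_exp_neg_mul_pow_zero {ι : Type*} {l : Filter ι} {z : ι → ℂ} {r : ι → ℝ}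
    {c s : ℝ} {k : ℕ} (hc : 0 < c) (hs : 0 < s) (hk : k ≠ 0)
    (hz : ∀ i, c ≤ (z i).re) (hr : Tendsto r l atTop) :
    Tendsto (fun i => Complex.exp (-z i * (s : ℂ) * ((r i : ℝ) : ℂ) ^ k)) l (nhds 0) := by
  rw [Complex.tendsto_exp_nhds_zero_iff]
  have hpow : Tendsto (fun i => c * s * r i ^ k) l atTop :=
    ((tendsto_pow_atTop hk).comp hr).const_mul_atTop (mul_pos hc hs)
  refine tendsto_atBot_mono' l ?_ (tendsto_neg_atTop_atBot.comp hpow)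
  filter_upwards [hr.eventually_ge_atTop 0] with i hi
  have hre : (-z i * (s : ℂ) * ((r i : ℝ) : ℂ) ^ k).re = -((z i).re * s * r i ^ k) := by
    rw [← Complex.ofReal_pow, Complex.re_mul_ofReal, Complex.re_mul_ofReal, Complex.neg_re]
    ring
  rw [hre]
  have := hz i
  simp only [Function.comp_apply]
  gcongr

theorem stmt_2 (d n : ℕ) (hd : 1 ≤ d) (hn : 1 ≤ n)
    (A : ℕ → Matrix (Fin d) (Fin d) ℂ) (σ : ℕ → ℝ)
    (hσ : ∀ k, 1 ≤ k → k ≤ n → 0 < σ k)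
    (c : ℝ) (hc : 0 < c)
    (ε : ℕ → ℝ) (hεpos : ∀ m, 0 < ε m) (hεlim : Tendsto ε atTop (nhds 0))
    (lam : ℕ → ℂ) (hroot : ∀ m, chiFn d n A σ (ε m) (lam m) = 0)
    (hre : ∀ m, c ≤ (lam m).re)
    (lam0 : ℂ) (hlim : Tendsto lam atTop (nhds lam0)) :
    Matrix.det (-lam0 • (1 : Matrix (Fin d) (Fin d) ℂ) + A 0) = 0 := by
  have hinv : Tendsto (fun m => (ε m)⁻¹) atTop atTop :=
    tendsto_inv_nhdsGT_zero.comp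
      (tendsto_nhdsWithin_iff.2 ⟨hεlim, Eventually.of_forall hεpos⟩)
  have hsum : Tendsto (fun m => ∑ k ∈ Finset.Icc 1 n,
      Complex.exp (-lam m * (σ k : ℂ) * ((((ε m)⁻¹ : ℝ) : ℂ)) ^ k) • A k) atTop (nhds 0) := by
    rw [← Finset.sum_const_zero (s := Finset.Icc 1 n)]
    refine tendsto_finsetSum _ fun k hk => ?_
    obtain ⟨hk1, hkn⟩ := Finset.mem_Icc.1 hk
    simpa using (tendsto_exp_neg_mul_pow_zero hc (hσ k hk1 hkn) (by lia) hre hinv).smul_const (A k)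
  have hmat := ((hlim.neg.smul_const (1 : Matrix (Fin d) (Fin d) ℂ)).add_const (A 0)).add hsum
  rw [add_zero] at hmat
  have hdet := (Continuous.matrix_det continuous_id).continuousAt.tendsto.comp hmat
  exact tendsto_nhds_unique hdet (tendsto_const_nhds.congr fun m => (hroot m).symm)
end

section
/- For every k with 1 ≤ k ≤ n, the limit lim_{ε→0⁺} ε^k · Ψ_k(ε) = ω₀/(2π) holds. -/
open Filter

/-- Ψ₁(ε) = ⌊ω₀/(2πε)⌋, Ψ_{j+1}(ε) = ⌊(φ_j/(2π) + Ψ_j(ε))/ε⌋. -/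
noncomputable def Psi (ω₀ : ℝ) (φ : ℕ → ℝ) (ε : ℝ) : ℕ → ℤ
  | 0 => 0
  | 1 => ⌊ω₀ / (2 * Real.pi * ε)⌋
  | (j + 2) => ⌊(φ (j + 1) / (2 * Real.pi) + ((Psi ω₀ φ ε (j + 1) : ℝ))) / ε⌋

theorem tendsto_pow_succ_mul_floor_div {x : ℝ → ℝ} {L : ℝ} (k : ℕ)
    (hx : Tendsto (fun ε : ℝ => ε ^ k * x ε) (nhdsWithin 0 (Set.Ioi 0)) (nhds L)) :
    Tendsto (fun ε : ℝ => ε ^ (k + 1) * (⌊x ε / ε⌋ : ℝ))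
      (nhdsWithin 0 (Set.Ioi 0)) (nhds L) := by
  have hpow : Tendsto (fun ε : ℝ => ε ^ (k + 1)) (nhdsWithin 0 (Set.Ioi 0)) (nhds 0) := by
    have h : Continuous (fun ε : ℝ => ε ^ (k + 1)) := by fun_prop
    simpa using (h.tendsto 0).mono_left nhdsWithin_le_nhds
  have hfract : Tendsto (fun ε : ℝ => ε ^ (k + 1) * Int.fract (x ε / ε))
      (nhdsWithin 0 (Set.Ioi 0)) (nhds 0) := by
    refine squeeze_zero' ?_ ?_ hpow <;> filter_upwards [self_mem_nhdsWithin] with ε hε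
    · exact mul_nonneg (pow_pos hε _).le (Int.fract_nonneg _)
    · exact mul_le_of_le_one_right (pow_pos hε _).le (Int.fract_lt_one _).le
  have hsub := hx.sub hfract
  rw [sub_zero] at hsub
  refine hsub.congr' ?_
  filter_upwards [self_mem_nhdsWithin] with ε hε
  have hε0 : ε ≠ 0 := ne_of_gt hε
  rw [Int.fract]
  field_simp
  ring

theorem tendsto_pow_succ_mul_Psi (ω₀ : ℝ) (φ : ℕ → ℝ) (k : ℕ) :
    Tendsto (fun ε : ℝ => ε ^ (k + 1) * (Psi ω₀ φ ε (k + 1) : ℝ))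
      (nhdsWithin 0 (Set.Ioi 0)) (nhds (ω₀ / (2 * Real.pi))) := by
  induction k with
  | zero =>
    simp only [Psi, ← div_div]
    exact tendsto_pow_succ_mul_floor_div (x := fun _ => ω₀ / 2 / Real.pi) 0 (by simp)
  | succ j ih =>
    simp only [Psi]
    refine tendsto_pow_succ_mul_floor_div (j + 1) ?_
    have hconst : Tendsto (fun ε : ℝ => ε ^ (j + 1) * (φ (j + 1) / (2 * Real.pi)))
        (nhdsWithin 0 (Set.Ioi 0)) (nhds 0) := by
      have h : Continuous (fun ε : ℝ => ε ^ (j + 1) * (φ (j + 1) / (2 * Real.pi))) := by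
        fun_prop
      simpa using (h.tendsto 0).mono_left nhdsWithin_le_nhds
    simpa only [mul_add, zero_add] using hconst.add ih

theorem stmt_3 (n : ℕ) (hn : 1 ≤ n) (ω₀ : ℝ) (φ : ℕ → ℝ)
    (k : ℕ) (hk1 : 1 ≤ k) (hkn : k ≤ n) :
    Tendsto (fun ε : ℝ => ε ^ k * ((Psi ω₀ φ ε k : ℝ)))
      (nhdsWithin 0 (Set.Ioi 0)) (nhds (ω₀ / (2 * Real.pi))) := by
  obtain ⟨j, rfl⟩ := Nat.exists_eq_add_of_le' hk1
  exact tendsto_pow_succ_mul_Psi ω₀ φ j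
end

section
/- For all integers j, k with 1 ≤ j < k ≤ n, the distance from ε^j · Ψ_k(ε) − φ_{k−j}/(2π) to the integers tends to 0 as ε → 0⁺; that is, lim_{ε→0⁺} inf_{m ∈ ℤ} |ε^j Ψ_k(ε) − φ_{k−j}/(2π) − m| = 0. -/
open Filter

theorem abs_mul_Psi_succ_sub_le (ω₀ : ℝ) (φ : ℕ → ℝ) {ε : ℝ} (hε : 0 < ε) (i : ℕ) :
    |ε * (Psi ω₀ φ ε (i + 2) : ℝ) - φ (i + 1) / (2 * Real.pi) - (Psi ω₀ φ ε (i + 1) : ℝ)|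
      ≤ ε := by
  rw [Psi]
  set y : ℝ := φ (i + 1) / (2 * Real.pi) + (Psi ω₀ φ ε (i + 1) : ℝ) with hy
  have hle : (⌊y / ε⌋ : ℝ) * ε ≤ y := (le_div_iff₀ hε).1 (Int.floor_le _)
  have hlt : y < ((⌊y / ε⌋ : ℝ) + 1) * ε := (div_lt_iff₀ hε).1 (Int.lt_floor_add_one _)
  rw [abs_le]
  constructor <;> linarith

theorem tendsto_mul_Psi_succ_sub (ω₀ : ℝ) (φ : ℕ → ℝ) (i : ℕ) :
    Tendsto (fun ε : ℝ => ε * (Psi ω₀ φ ε (i + 2) : ℝ) - φ (i + 1) / (2 * Real.pi)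
        - (Psi ω₀ φ ε (i + 1) : ℝ)) (nhdsWithin 0 (Set.Ioi 0)) (nhds 0) := by
  refine squeeze_zero_norm' ?_ (tendsto_nhdsWithin_of_tendsto_nhds tendsto_id)
  filter_upwards [self_mem_nhdsWithin] with ε hε
  exact abs_mul_Psi_succ_sub_le ω₀ φ hε i

theorem tendsto_pow_mul_Psi_sub (ω₀ : ℝ) (φ : ℕ → ℝ) (i d : ℕ) :
    Tendsto (fun ε : ℝ => ε ^ (d + 1) * (Psi ω₀ φ ε (i + d + 2) : ℝ)
        - φ (i + 1) / (2 * Real.pi) - (Psi ω₀ φ ε (i + 1) : ℝ))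
      (nhdsWithin 0 (Set.Ioi 0)) (nhds 0) := by
  induction d with
  | zero => simpa using tendsto_mul_Psi_succ_sub ω₀ φ i
  | succ d ih =>
    have hpow : Tendsto (fun ε : ℝ => ε ^ (d + 1)) (nhdsWithin 0 (Set.Ioi 0)) (nhds 0) :=
      tendsto_nhdsWithin_of_tendsto_nhds (by simpa using (continuous_pow (d + 1)).tendsto (0 : ℝ))
    have hsum := ih.add (hpow.mul ((tendsto_mul_Psi_succ_sub ω₀ φ (i + d + 1)).add_const
      (φ (i + d + 2) / (2 * Real.pi))))
    rw [zero_mul, add_zero] at hsum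
    refine hsum.congr fun ε => ?_
    rw [show i + (d + 1) + 2 = i + d + 1 + 2 by ring]
    ring

theorem stmt_4 (n : ℕ) (hn : 2 ≤ n) (ω₀ : ℝ) (φ : ℕ → ℝ)
    (j k : ℕ) (hj : 1 ≤ j) (hjk : j < k) (hkn : k ≤ n) :
    Tendsto (fun ε : ℝ =>
        ⨅ m : ℤ, |ε ^ j * ((Psi ω₀ φ ε k : ℝ)) - φ (k - j) / (2 * Real.pi) - (m : ℝ)|)
      (nhdsWithin 0 (Set.Ioi 0)) (nhds 0) := by
  obtain ⟨d, rfl⟩ := Nat.exists_eq_add_of_le' hj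
  obtain ⟨i, rfl⟩ : ∃ i, k = i + d + 2 := ⟨k - d - 2, by omega⟩
  rw [show i + d + 2 - (d + 1) = i + 1 by omega]
  have habs := (tendsto_pow_mul_Psi_sub ω₀ φ i d).abs
  rw [abs_zero] at habs
  refine squeeze_zero (fun ε => Real.iInf_nonneg fun m => abs_nonneg _) (fun ε => ?_) habs
  exact ciInf_le ⟨0, by rintro _ ⟨m, rfl⟩; exact abs_nonneg _⟩ (Psi ω₀ φ ε (i + 1))
end

section
/- Assume A_n is invertible. Then for every R > 0 and every M > 0 there exists ε₀ > 0 such that for every 0 < ε < ε₀ and every λ ∈ ℂ with Re λ ≤ −M and |Im λ| ≤ R, one has χ^ε(λ) ≠ 0. -/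
open Matrix Complex

section PerturbationBounds

open Filter Topology

attribute [local instance] Matrix.linftyOpNormedRing Matrix.linftyOpNormedAlgebra

/-- A scalar multiple of an invertible matrix stays invertible under a perturbation that is small
relative to the scalar. -/
theorem exists_det_smul_add_ne_zero {d : ℕ} (hd : 1 ≤ d) {A : Matrix (Fin d) (Fin d) ℂ}
    (hA : IsUnit A) :
    ∃ δ > (0 : ℝ), ∀ (c : ℂ) (W : Matrix (Fin d) (Fin d) ℂ), c ≠ 0 → ‖c⁻¹ • W‖ < δ →
      (c • A + W).det ≠ 0 := by
  obtain ⟨u, rfl⟩ := hA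
  have : Nonempty (Fin d) := ⟨⟨0, hd⟩⟩
  have : CompleteSpace (Matrix (Fin d) (Fin d) ℂ) := FiniteDimensional.complete ℂ _
  refine ⟨‖(↑u⁻¹ : Matrix (Fin d) (Fin d) ℂ)‖⁻¹, inv_pos.2 (norm_pos_iff.2 u⁻¹.ne_zero), ?_⟩
  intro c W hc hW
  have hunit : IsUnit ((u : Matrix (Fin d) (Fin d) ℂ) + c⁻¹ • W) := ⟨u.add _ hW, rfl⟩
  have heq : c • (u : Matrix (Fin d) (Fin d) ℂ) + W = c • ((u : Matrix _ _ ℂ) + c⁻¹ • W) := by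
    rw [smul_add, smul_smul, mul_inv_cancel₀ hc, one_smul]
  rw [heq, Matrix.det_smul]
  exact mul_ne_zero (pow_ne_zero _ hc) ((Matrix.isUnit_iff_isUnit_det _).1 hunit).ne_zero

theorem norm_exp_neg_mul_pow (z : ℂ) (s t : ℝ) (k : ℕ) :
    ‖Complex.exp (-z * (s : ℂ) * (t : ℂ) ^ k)‖ = Real.exp (-z.re * (s * t ^ k)) := by
  have : -z * (s : ℂ) * (t : ℂ) ^ k = ((s * t ^ k : ℝ) : ℂ) * (-z) := by push_cast; ring
  rw [Complex.norm_exp, this, Complex.re_ofReal_mul, Complex.neg_re, mul_comm]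

/-- The terms other than the dominant exponential one grow at most like the square root of the
latter. -/
theorem norm_subdominant_le {d n : ℕ} (A : ℕ → Matrix (Fin d) (Fin d) ℂ) (σ : ℕ → ℝ)
    {R t s : ℝ} {z : ℂ} (hR : 0 ≤ R) (hre : z.re ≤ 0) (him : |z.im| ≤ R) (hs : -z.re ≤ s)
    (hk : ∀ k ∈ Finset.Ico 1 n, -z.re * (σ k * t ^ k) ≤ s) :
    ‖-z • (1 : Matrix (Fin d) (Fin d) ℂ) + A 0 +
      ∑ k ∈ Finset.Ico 1 n, Complex.exp (-z * (σ k : ℂ) * (t : ℂ) ^ k) • A k‖ ≤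
    Real.exp s * ((1 + R) * ‖(1 : Matrix (Fin d) (Fin d) ℂ)‖ + ‖A 0‖ +
      ∑ k ∈ Finset.Ico 1 n, ‖A k‖) := by
  have hone : 1 ≤ Real.exp s := Real.one_le_exp (by linarith)
  have hz : ‖z‖ ≤ Real.exp s * (1 + R) := by
    have h1 := Complex.norm_le_abs_re_add_abs_im z
    rw [abs_of_nonpos hre] at h1
    have h2 := Real.add_one_le_exp s
    nlinarith [mul_nonneg (sub_nonneg.2 hone) hR]
  have h1 : ‖-z • (1 : Matrix (Fin d) (Fin d) ℂ)‖ ≤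
      Real.exp s * ((1 + R) * ‖(1 : Matrix (Fin d) (Fin d) ℂ)‖) := by
    rw [norm_smul, norm_neg, ← mul_assoc]
    gcongr
  have h2 : ‖A 0‖ ≤ Real.exp s * ‖A 0‖ := le_mul_of_one_le_left (norm_nonneg _) hone
  have h3 : ‖∑ k ∈ Finset.Ico 1 n, Complex.exp (-z * (σ k : ℂ) * (t : ℂ) ^ k) • A k‖ ≤
      Real.exp s * ∑ k ∈ Finset.Ico 1 n, ‖A k‖ := by
    rw [Finset.mul_sum]
    refine norm_sum_le_of_le _ fun k hkn => ?_
    rw [norm_smul, norm_exp_neg_mul_pow]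
    gcongr
    exact hk k hkn
  calc _ ≤ _ := norm_add₃_le
    _ ≤ _ := add_le_add_three h1 h2 h3
    _ = _ := by ring

/-- For large `t` the exponent `σ n * t ^ n` dominates twice the lower ones. -/
theorem exists_threshold {n : ℕ} (hn : 1 ≤ n) {σ : ℕ → ℝ} (hσ : 0 < σ n) {M δ : ℝ}
    (hM : 0 < M) (hδ : 0 < δ) (K : ℝ) :
    ∃ T > (0 : ℝ), ∀ t > T, 1 ≤ σ n * t ^ n / 2 ∧
      (∀ k ∈ Finset.Ico 1 n, σ k * t ^ k ≤ σ n * t ^ n / 2) ∧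
      Real.exp (-(M * (σ n * t ^ n / 2))) * K < δ := by
  have hlim : Tendsto (fun t : ℝ => σ n * t ^ n / 2) atTop atTop :=
    ((tendsto_pow_atTop (by omega)).const_mul_atTop hσ).atTop_div_const two_pos
  have hexp : Tendsto (fun t : ℝ => Real.exp (-(M * (σ n * t ^ n / 2))) * K) atTop (𝓝 0) := by
    simpa using (Real.tendsto_exp_neg_atTop_nhds_zero.comp
      (hlim.const_mul_atTop hM)).mul_const K
  have hlow : ∀ᶠ t : ℝ in atTop, ∀ k ∈ Finset.Ico 1 n, σ k * t ^ k ≤ σ n * t ^ n / 2 := by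
    rw [Filter.eventually_all_finset]
    intro k hk
    filter_upwards [eventually_ge_atTop 1, eventually_ge_atTop (2 * |σ k| / σ n)] with t h1 h2
    rw [div_le_iff₀ hσ] at h2
    have hpow : t ^ k * t ≤ t ^ n := by
      rw [← pow_succ]
      exact pow_le_pow_right₀ h1 (Finset.mem_Ico.1 hk).2
    have hk0 : 0 ≤ t ^ k := by positivity
    have h3 := mul_le_mul_of_nonneg_left hpow hσ.le
    have h4 := mul_le_mul_of_nonneg_right (le_abs_self (σ k)) hk0
    have h5 := mul_le_mul_of_nonneg_right h2 hk0
    linarith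
  obtain ⟨T, hT⟩ := eventually_atTop.1
    ((hlim.eventually_ge_atTop 1).and (hlow.and (hexp.eventually_lt_const hδ)))
  exact ⟨max T 1, by positivity, fun t ht => hT t ((le_max_left _ _).trans ht.le)⟩

theorem exists_forall_chiFn_ne_zero {d n : ℕ} (hd : 1 ≤ d) (hn : 1 ≤ n)
    (A : ℕ → Matrix (Fin d) (Fin d) ℂ) {σ : ℕ → ℝ} (hσ : 0 < σ n) (hAn : IsUnit (A n))
    {R M : ℝ} (hR : 0 ≤ R) (hM : 0 < M) :
    ∃ ε₀ > (0 : ℝ), ∀ ε : ℝ, 0 < ε → ε < ε₀ →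
      ∀ z : ℂ, z.re ≤ -M → |z.im| ≤ R → chiFn d n A σ ε z ≠ 0 := by
  obtain ⟨δ, hδ, hdet⟩ := exists_det_smul_add_ne_zero hd hAn
  set K : ℝ := (1 + R) * ‖(1 : Matrix (Fin d) (Fin d) ℂ)‖ + ‖A 0‖ +
    ∑ k ∈ Finset.Ico 1 n, ‖A k‖ with hK
  have hK0 : 0 ≤ K := by positivity
  obtain ⟨T, hT0, hT⟩ := exists_threshold hn hσ hM hδ K
  refine ⟨T⁻¹, inv_pos.2 hT0, fun ε hε hεT z hre him => ?_⟩
  obtain ⟨h1, h2, h3⟩ := hT ε⁻¹ ((lt_inv_comm₀ hε hT0).1 hεT)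
  set q : ℝ := σ n * ε⁻¹ ^ n / 2 with hq
  have hx : 0 ≤ -z.re := by linarith
  have hW := norm_subdominant_le (n := n) A σ (t := ε⁻¹) (s := -z.re * q) hR (by linarith) him
    (le_mul_of_one_le_right hx h1) fun k hk => mul_le_mul_of_nonneg_left (h2 k hk) hx
  rw [← hK] at hW
  rw [chiFn, ← Finset.Ico_insert_right hn, Finset.sum_insert Finset.right_notMem_Ico,
    add_left_comm]
  refine hdet _ _ (Complex.exp_ne_zero _) ?_
  rw [norm_smul, norm_inv, norm_exp_neg_mul_pow, ← Real.exp_neg]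
  have hexp : Real.exp (-(-z.re * (σ n * ε⁻¹ ^ n))) * Real.exp (-z.re * q) =
      Real.exp (-(-z.re * q)) := by
    rw [← Real.exp_add, hq]
    ring_nf
  calc _ ≤ Real.exp (-(-z.re * (σ n * ε⁻¹ ^ n))) * (Real.exp (-z.re * q) * K) := by gcongr
    _ = Real.exp (-(-z.re * q)) * K := by rw [← mul_assoc, hexp]
    _ ≤ Real.exp (-(M * q)) * K := by
      gcongr
      linarith
    _ < δ := h3

end PerturbationBounds

theorem stmt_10 (d n : ℕ) (hd : 1 ≤ d) (hn : 1 ≤ n)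
    (A : ℕ → Matrix (Fin d) (Fin d) ℂ) (σ : ℕ → ℝ)
    (hσ : ∀ k, 1 ≤ k → k ≤ n → 0 < σ k)
    (hAn : IsUnit (A n)) :
    ∀ R > (0 : ℝ), ∀ M > (0 : ℝ), ∃ ε₀ > (0 : ℝ), ∀ ε : ℝ, 0 < ε → ε < ε₀ →
      ∀ lam : ℂ, lam.re ≤ -M → |lam.im| ≤ R → chiFn d n A σ ε lam ≠ 0 := by
  intro R hR M hM
  exact exists_forall_chiFn_ne_zero hd hn A (hσ n hn le_rfl) hAn hR.le hM
end

section
/- Let 1 ≤ r < d, let B, A ∈ ℂ^{d×d}, let U, V ∈ ℂ^{d×d} be unitary, and let D ∈ ℂ^{r×r} be invertible such that U*AV is the block-diagonal matrix with blocks 0 ∈ ℂ^{(d−r)×(d−r)} and D (i.e. U*AV = diag(0, D)). Let U₁, V₁ ∈ ℂ^{d×(d−r)} consist of the first d−r columns of U and V respectively. Then the function Y ↦ det(B + Y·A) is a polynomial in Y ∈ ℂ of degree at most r whose coefficient of Y^r equals det(U V*)·det(U₁* B V₁)·det(D); in particular this leading coefficient is nonzero if and only if det(U₁* B V₁) ≠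 0, and the constant term equals det B. -/
open Matrix

namespace Polynomial

variable {R : Type*} [CommRing R]

theorem coeff_prod_sum_of_natDegree_le {ι : Type*} (s : Finset ι) (f : ι → R[X]) (d : ι → ℕ)
    (h : ∀ i ∈ s, (f i).natDegree ≤ d i) :
    (∏ i ∈ s, f i).coeff (∑ i ∈ s, d i) = ∏ i ∈ s, (f i).coeff (d i) := by
  classical
  induction s using Finset.induction_on with
  | empty => simp
  | insert a s ha ih =>
    have hs : ∀ i ∈ s, (f i).natDegree ≤ d i := fun i hi => h i (Finset.mem_insert_of_mem hi)
    rw [Finset.prod_insert ha, Finset.sum_insert ha, Finset.prod_insert ha, ← ih hs]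
    exact coeff_mul_add_eq_of_natDegree_le (h a (Finset.mem_insert_self a s))
      ((natDegree_prod_le s f).trans (Finset.sum_le_sum hs))

variable {n : Type*} [Fintype n] [DecidableEq n]

theorem natDegree_det_le_sum_of_natDegree_le (M : Matrix n n R[X]) (d : n → ℕ)
    (h : ∀ i j, (M i j).natDegree ≤ d i) : M.det.natDegree ≤ ∑ i, d i := by
  rw [← det_transpose, det_apply]
  refine natDegree_sum_le_of_forall_le _ _ fun σ _ => ?_
  exact (natDegree_smul_le _ _).trans
    ((natDegree_prod_le _ _).trans (Finset.sum_le_sum fun i _ => h i _))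

theorem coeff_det_sum_of_natDegree_le (M : Matrix n n R[X]) (d : n → ℕ)
    (h : ∀ i j, (M i j).natDegree ≤ d i) :
    M.det.coeff (∑ i, d i) = (Matrix.of fun i j => (M i j).coeff (d i)).det := by
  rw [← det_transpose, det_apply, ← det_transpose, det_apply, finsetSum_coeff]
  refine Finset.sum_congr rfl fun σ _ => ?_
  rw [coeff_smul]
  congr 1
  exact coeff_prod_sum_of_natDegree_le _ _ _ fun i _ => h i _

end Polynomial

namespace Matrix

open Polynomial

variable {R m n : Type*} [CommRing R] [Fintype m] [Fintype n] [DecidableEq m] [DecidableEq n]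

/-- A matrix pencil whose linear term is supported on the lower right block has a determinant
of degree at most the size of that block, with an explicit top coefficient. -/
theorem exists_polynomial_det_add_smul_fromBlocks (M : Matrix (m ⊕ n) (m ⊕ n) R)
    (D : Matrix n n R) :
    ∃ P : R[X], (∀ y : R, P.eval y = (M + y • fromBlocks 0 0 0 D).det) ∧
      P.natDegree ≤ Fintype.card n ∧ P.coeff (Fintype.card n) = M.toBlocks₁₁.det * D.det := by
  let Q : Matrix (m ⊕ n) (m ⊕ n) R[X] :=
    of fun i j => C (M i j) + X * C (fromBlocks 0 0 0 D i j)
  let d : m ⊕ n → ℕ := Sum.elim (fun _ => 0) fun _ => 1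
  have hd : ∑ i, d i = Fintype.card n := by simp [d]
  have hQ : ∀ i j, (Q i j).natDegree ≤ d i := by
    rintro (i | i) j
    · cases j <;> simp [Q, d]
    · simp only [Q, d, of_apply, Sum.elim_inr]
      compute_degree
  refine ⟨Q.det, fun y => ?_, hd ▸ natDegree_det_le_sum_of_natDegree_le Q d hQ, ?_⟩
  · rw [← coe_evalRingHom, RingHom.map_det]
    congr 1
    ext i j
    simp [Q, mul_comm y]
  · rw [← hd, coeff_det_sum_of_natDegree_le Q d hQ, ← det_fromBlocks_zero₂₁ _ M.toBlocks₁₂]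
    congr 1
    ext (i | i) (j | j) <;> simp [Q, d, toBlocks₁₁, toBlocks₁₂, coeff_C]

end Matrix

/-- here `d − r` is encoded as `p ≥ 1`, with the square matrices of size
`d = p + r` indexed by `Fin p ⊕ Fin r` (first `p` coordinates ↔ first `d − r` columns). -/
theorem stmt_12 (p r : ℕ) (hp : 1 ≤ p) (hr : 1 ≤ r)
    (B A U V : Matrix (Fin p ⊕ Fin r) (Fin p ⊕ Fin r) ℂ)
    (D : Matrix (Fin r) (Fin r) ℂ) (hD : IsUnit D)
    (hU : Uᴴ * U = 1) (hV : Vᴴ * V = 1)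
    (hUAV : Uᴴ * A * V = Matrix.fromBlocks 0 0 0 D)
    (U₁ V₁ : Matrix (Fin p ⊕ Fin r) (Fin p) ℂ)
    (hU₁ : U₁ = fun i j => U i (Sum.inl j))
    (hV₁ : V₁ = fun i j => V i (Sum.inl j)) :
    ∃ P : Polynomial ℂ,
      (∀ Y : ℂ, P.eval Y = Matrix.det (B + Y • A)) ∧
      P.natDegree ≤ r ∧
      P.coeff r = Matrix.det (U * Vᴴ) * Matrix.det (U₁ᴴ * B * V₁) * Matrix.det D ∧
      (P.coeff r ≠ 0 ↔ Matrix.det (U₁ᴴ * B * V₁) ≠ 0) ∧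
      P.coeff 0 = Matrix.det B := by
  have hU' : U * Uᴴ = 1 := mul_eq_one_comm.mp hU
  have hV' : V * Vᴴ = 1 := mul_eq_one_comm.mp hV
  obtain ⟨P, hP, hdeg, hcoeff⟩ := exists_polynomial_det_add_smul_fromBlocks (Uᴴ * B * V) D
  rw [Fintype.card_fin] at hdeg hcoeff
  have hblock : (Uᴴ * B * V).toBlocks₁₁ = U₁ᴴ * B * V₁ := by
    subst hU₁ hV₁
    rfl
  rw [hblock] at hcoeff
  have heval : ∀ Y : ℂ, (Polynomial.C (U * Vᴴ).det * P).eval Y = (B + Y • A).det := fun Y => by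
    have hconj : B + Y • A = U * (Uᴴ * B * V + Y • (Uᴴ * A * V)) * Vᴴ := by
      have h : Uᴴ * B * V + Y • (Uᴴ * A * V) = Uᴴ * (B + Y • A) * V := by
        simp [Matrix.mul_add, Matrix.add_mul]
      rw [h, Matrix.mul_assoc Uᴴ, ← Matrix.mul_assoc U, hU', Matrix.one_mul, Matrix.mul_assoc,
        hV', Matrix.mul_one]
    rw [Polynomial.eval_mul, Polynomial.eval_C, hP, hconj, hUAV]
    simp only [det_mul]
    ring
  have htop : (Polynomial.C (U * Vᴴ).det * P).coeff r =
      (U * Vᴴ).det * (U₁ᴴ * B * V₁).det * D.det := by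
    rw [Polynomial.coeff_C_mul, hcoeff, mul_assoc]
  have hUV : (U * Vᴴ).det ≠ 0 := by
    refine (isUnit_iff_isUnit_det _).mp ?_ |>.ne_zero
    exact (IsUnit.of_mul_eq_one _ hU').mul (IsUnit.of_mul_eq_one_right _ hV')
  have hdet : D.det ≠ 0 := ((isUnit_iff_isUnit_det D).mp hD).ne_zero
  refine ⟨_, heval, (Polynomial.natDegree_C_mul_le _ _).trans hdeg, htop, ?_, ?_⟩
  · rw [htop]
    simp [hUV, hdet, -det_mul]
  · rw [Polynomial.coeff_zero_eq_eval_zero, heval]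
    simp
end

section
/- Let 1 ≤ r < d, let J, A ∈ ℂ^{d×d}, let U, V ∈ ℂ^{d×d} be unitary, and let J₄ ∈ ℂ^{r×r} be invertible such that U*JV = diag(0, J₄) (block-diagonal with zero block of size d−r). Write U = [U₁ U₂] and V = [V₁ V₂], where U₁, V₁ consist of the first d−r columns and U₂, V₂ of the last r columns. Assume the matrix U₁* A V₁ ∈ ℂ^{(d−r)×(d−r)} is invertible. Then for every z ∈ ℂ: det(−zJ + A) = 0 if and only if z is an eigenvalue of the matrix J₄^{−1}·(U₂* A V₂ − U₂* A V₁ · (U₁* A V₁)^{−1} · U₁* A V₂). In particular the polynomial z ↦ det(−zJ + A) is not identically zero. -/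
open Matrix

/-- The determinant of the pencil `fromBlocks A B C D - z • fromBlocks 0 0 0 J` factors
through the characteristic polynomial of `J⁻¹` times the Schur complement. -/
theorem Matrix.det_fromBlocks_sub_smul {m n R : Type*} [Fintype m] [Fintype n] [DecidableEq m]
    [DecidableEq n] [CommRing R] (A : Matrix m m R) (B : Matrix m n R) (C : Matrix n m R)
    (D J : Matrix n n R) (hA : IsUnit A) (hJ : IsUnit J) (z : R) :
    (fromBlocks A B C (D - z • J)).det =
      A.det * J.det * (-1) ^ Fintype.card n *
        (J⁻¹ * (D - C * A⁻¹ * B)).charpoly.eval z := by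
  have : Invertible A := hA.invertible
  have hJJ : J * J⁻¹ = 1 := mul_nonsing_inv J ((isUnit_iff_isUnit_det J).mp hJ)
  have hfac : D - z • J - C * A⁻¹ * B =
      J * -(scalar n z - J⁻¹ * (D - C * A⁻¹ * B)) := by
    rw [neg_sub, mul_sub, ← mul_assoc, hJJ, one_mul, scalar_apply,
      ← smul_one_eq_diagonal, Matrix.mul_smul, mul_one]
    abel
  rw [det_fromBlocks₁₁, invOf_eq_nonsing_inv, hfac, det_mul, det_neg, eval_charpoly]
  ring

/-- here `d − r` is encoded as `p ≥ 1`, with the square matrices of size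
`d = p + r` indexed by `Fin p ⊕ Fin r`; `U₁, V₁` are the first `d − r` columns and
`U₂, V₂` the last `r` columns of `U` and `V`. -/
theorem stmt_14 (p r : ℕ) (hp : 1 ≤ p) (hr : 1 ≤ r)
    (J A U V : Matrix (Fin p ⊕ Fin r) (Fin p ⊕ Fin r) ℂ)
    (J₄ : Matrix (Fin r) (Fin r) ℂ) (hJ₄ : IsUnit J₄)
    (hU : Uᴴ * U = 1) (hV : Vᴴ * V = 1)
    (hUJV : Uᴴ * J * V = Matrix.fromBlocks 0 0 0 J₄)
    (U₁ V₁ : Matrix (Fin p ⊕ Fin r) (Fin p) ℂ)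
    (U₂ V₂ : Matrix (Fin p ⊕ Fin r) (Fin r) ℂ)
    (hU₁ : U₁ = fun i j => U i (Sum.inl j))
    (hV₁ : V₁ = fun i j => V i (Sum.inl j))
    (hU₂ : U₂ = fun i j => U i (Sum.inr j))
    (hV₂ : V₂ = fun i j => V i (Sum.inr j))
    (hA11 : IsUnit (U₁ᴴ * A * V₁)) :
    (∀ z : ℂ, Matrix.det (-z • J + A) = 0 ↔
      (Matrix.charpoly (J₄⁻¹ *
        (U₂ᴴ * A * V₂ - U₂ᴴ * A * V₁ * (U₁ᴴ * A * V₁)⁻¹ * (U₁ᴴ * A * V₂)))).IsRoot z) ∧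
    ∃ z : ℂ, Matrix.det (-z • J + A) ≠ 0 := by
  set S := J₄⁻¹ *
    (U₂ᴴ * A * V₂ - U₂ᴴ * A * V₁ * (U₁ᴴ * A * V₁)⁻¹ * (U₁ᴴ * A * V₂))
  have hblocks : Uᴴ * A * V =
      fromBlocks (U₁ᴴ * A * V₁) (U₁ᴴ * A * V₂) (U₂ᴴ * A * V₁) (U₂ᴴ * A * V₂) := by
    subst hU₁ hV₁ hU₂ hV₂
    ext (i | i) (j | j) <;> rfl
  have hpencil (z : ℂ) : Uᴴ * (-z • J + A) * V =
      fromBlocks (U₁ᴴ * A * V₁) (U₁ᴴ * A * V₂) (U₂ᴴ * A * V₁) (U₂ᴴ * A * V₂ - z • J₄) := by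
    rw [mul_add, add_mul, Matrix.mul_smul, Matrix.smul_mul, hUJV, hblocks, fromBlocks_smul, fromBlocks_add]
    simp [sub_eq_neg_add]
  have hdet (z : ℂ) : Uᴴ.det * (-z • J + A).det * V.det =
      (U₁ᴴ * A * V₁).det * J₄.det * (-1) ^ Fintype.card (Fin r) * S.charpoly.eval z := by
    rw [← det_mul, ← det_mul, hpencil, det_fromBlocks_sub_smul _ _ _ _ _ hA11 hJ₄]
  have hUdet : U.det ≠ 0 := (isUnit_det_of_left_inverse hU).ne_zero
  have hVdet : V.det ≠ 0 := (isUnit_det_of_left_inverse hV).ne_zero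
  have hAdet := ((isUnit_iff_isUnit_det _).mp hA11).ne_zero
  have hJdet := ((isUnit_iff_isUnit_det _).mp hJ₄).ne_zero
  have hiff (z : ℂ) : (-z • J + A).det = 0 ↔ S.charpoly.IsRoot z := by
    have h := congrArg (· = 0) (hdet z)
    simpa [hUdet, hVdet, hAdet, hJdet, Polynomial.IsRoot] using h
  refine ⟨hiff, ?_⟩
  obtain ⟨z, hz⟩ := Polynomial.exists_eval_ne_zero_of_natDegree_lt_card S.charpoly
    (charpoly_monic S).ne_zero
    (by simpa using Cardinal.natCast_lt_aleph0.trans_le (Cardinal.aleph0_le_mk ℂ))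
  exact ⟨z, fun h => hz ((hiff z).mp h)⟩
end
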